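/- For a positive integer q, all coefficients of the formal binomial series (1+X)^{1/q} = Σ_{k≥0} C(1/q, k) X^k lie in ℤ[1/q]; i.e. for every k, the generalized binomial coefficient C(1/q, k) = (1/q)(1/q − 1)⋯(1/q − k + 1)/k! can be written as m/q^n with m ∈ ℤ and n ∈ ℕ. -/

import Mathlib

/-- The generalized binomial coefficient `C(x, k) = x(x−1)⋯(x−k+1)/k!` for `x : ℚ`. -/
def qChoose (x : ℚ) (k : ℕ) : ℚ :=
  (∏ i ∈ Finset.range k, (x - i)) / (Nat.factorial k)

lemma aux_split (q : ℕ) (N : ℕ) (hN : 0 < N) :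
    ∃ A B n : ℕ, N = A * B ∧ Nat.Coprime A q ∧ B ∣ q ^ n := by
  induction N using Nat.strong_induction_on with
  | _ N ih =>
    by_cases hc : Nat.Coprime N q
    · exact ⟨N, 1, 0, by simp, hc, by simp⟩
    · obtain ⟨N', hN'⟩ := Nat.gcd_dvd_left N q
      have hg : 0 < Nat.gcd N q := Nat.gcd_pos_of_pos_left _ hN
      have hg1 : Nat.gcd N q ≠ 1 := hc
      have hpos : 0 < N' := by
        rcases Nat.eq_zero_or_pos N' with h | h
        · rw [h] at hN'; omega
        · exact h
      have hlt : N' < N := by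
        have : 2 * N' ≤ Nat.gcd N q * N' := Nat.mul_le_mul_right _ (by omega)
        omega
      obtain ⟨A, B, n, h1, h2, h3⟩ := ih N' hlt hpos
      refine ⟨A, Nat.gcd N q * B, n + 1, ?_, h2, ?_⟩
      · calc N = Nat.gcd N q * N' := hN'
          _ = Nat.gcd N q * (A * B) := by rw [← h1]
          _ = _ := by ring
      · rw [pow_succ, mul_comm (q ^ n)]
        exact Nat.mul_dvd_mul (Nat.gcd_dvd_right N q) h3

lemma aux_desc (b k : ℕ) :
    ((b.descFactorial k : ℕ) : ℤ) = ∏ i ∈ Finset.range k, ((b : ℤ) - i) := by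
  induction k with
  | zero => simp
  | succ k ih =>
    rw [Finset.prod_range_succ, ← ih, Nat.descFactorial_succ]
    rcases le_or_gt k b with h | h
    · push_cast [h]; ring
    · rw [Nat.descFactorial_of_lt h]; simp

lemma aux_dvd (q k A : ℕ) (hA : Nat.Coprime A q) (hk : A ∣ k.factorial) :
    (A : ℤ) ∣ ∏ i ∈ Finset.range k, (1 - (i : ℤ) * q) := by
  have hA0 : 0 < A := Nat.pos_of_dvd_of_pos hk (Nat.factorial_pos k)
  haveI : NeZero A := ⟨hA0.ne'⟩
  let b : ℕ := ((q : ZMod A)⁻¹).val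
  have hb : (q : ZMod A) * (b : ZMod A) = 1 := by
    simp only [b, ZMod.natCast_zmod_val]
    exact ZMod.coe_mul_inv_eq_one q hA.symm
  have h0 : ((∏ i ∈ Finset.range k, ((b : ℤ) - i) : ℤ) : ZMod A) = 0 := by
    rw [ZMod.intCast_zmod_eq_zero_iff_dvd, ← aux_desc]
    exact_mod_cast hk.trans (Nat.factorial_dvd_descFactorial b k)
  rw [← ZMod.intCast_zmod_eq_zero_iff_dvd]
  push_cast at h0 ⊢
  have : ∏ i ∈ Finset.range k, (1 - (i : ZMod A) * q)
      = ∏ i ∈ Finset.range k, ((q : ZMod A) * ((b : ZMod A) - i)) := by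
    refine Finset.prod_congr rfl fun i _ => ?_
    rw [mul_sub, hb]; ring
  rw [this, Finset.prod_mul_distrib, h0, mul_zero]

/-- all coefficients `C(1/q, k)` of the binomial series `(1+X)^{1/q}`
lie in `ℤ[1/q]`: each can be written as `m / q^n` with `m ∈ ℤ`, `n ∈ ℕ`. -/
theorem qChoose_mem_int_inv_q (q : ℕ) (hq : 0 < q) (k : ℕ) :
    ∃ (m : ℤ) (n : ℕ), qChoose (1 / q) k = (m : ℚ) / (q : ℚ) ^ n := by
  obtain ⟨A, B, n, h1, h2, D, h3⟩ := aux_split q k.factorial (Nat.factorial_pos k)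
  obtain ⟨c, hc⟩ := aux_dvd q k A h2 ⟨B, h1⟩
  have hq0 : (q : ℚ) ≠ 0 := by exact_mod_cast hq.ne'
  have hAB : A * B ≠ 0 := h1 ▸ (Nat.factorial_pos k).ne'
  have hA : (A : ℚ) ≠ 0 := by exact_mod_cast left_ne_zero_of_mul hAB
  have hB : (B : ℚ) ≠ 0 := by exact_mod_cast right_ne_zero_of_mul hAB
  have hc' : ∏ i ∈ Finset.range k, (1 - (i : ℚ) * q) = A * c := by exact_mod_cast hc
  have h3' : (q : ℚ) ^ n = B * D := by exact_mod_cast h3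
  have hD : (D : ℚ) ≠ 0 := by
    intro h
    rw [h, mul_zero] at h3'
    exact pow_ne_zero n hq0 h3'
  have hp : ∏ i ∈ Finset.range k, (1 / (q : ℚ) - i) = A * c / (q : ℚ) ^ k := by
    rw [eq_div_iff (pow_ne_zero k hq0), ← hc']
    conv_lhs => rw [← Finset.card_range k, ← Finset.prod_const, Finset.card_range]
    rw [← Finset.prod_mul_distrib]
    refine Finset.prod_congr rfl fun i _ => ?_
    field_simp
  refine ⟨c * D, k + n, ?_⟩
  rw [qChoose, hp, h1, pow_add, h3']
  push_cast
  field_simp
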